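/- Let G : ℝ³ → [0, ∞) be a nonzero continuous function with compact support, and let λ, μ be finite nonnegative compactly supported Borel measures on ℝ³ with G * λ = G * μ (as functions or measures). Then λ = μ. In particular, the map μ ↦ G * μ is injective on compactly supported finite nonnegative measures. -/

import Mathlib

open MeasureTheory Metric

/-- The Laplace transform turns convolution into a product. -/
lemma lintegral_exp_inner_mul_lconvolution {E : Type*} [NormedAddCommGroup E]
    [InnerProductSpace ℝ E] [FiniteDimensional ℝ E] [MeasurableSpace E] [BorelSpace E]
    (ν : Measure E) [SFinite ν] {g : E → ENNReal} (hg : Measurable g) (t : E) :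
    ∫⁻ x, ENNReal.ofReal (Real.exp (inner ℝ t x)) * ∫⁻ y, g (x - y) ∂ν =
      (∫⁻ x, ENNReal.ofReal (Real.exp (inner ℝ t x)) * g x) *
        ∫⁻ y, ENNReal.ofReal (Real.exp (inner ℝ t y)) ∂ν := by
  have he : Measurable fun x : E ↦ ENNReal.ofReal (Real.exp (inner ℝ t x)) := by fun_prop
  calc ∫⁻ x, ENNReal.ofReal (Real.exp (inner ℝ t x)) * ∫⁻ y, g (x - y) ∂ν
      = ∫⁻ x, ∫⁻ y, ENNReal.ofReal (Real.exp (inner ℝ t x)) * g (x - y) ∂ν := by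
        refine lintegral_congr fun x ↦ ?_
        rw [lintegral_const_mul _ (by fun_prop)]
    _ = ∫⁻ y, (∫⁻ x, ENNReal.ofReal (Real.exp (inner ℝ t x)) * g (x - y)) ∂ν := by
        refine lintegral_lintegral_swap (Measurable.aemeasurable ?_)
        simp only [Function.uncurry_def]
        fun_prop
    _ = ∫⁻ y, (∫⁻ x, ENNReal.ofReal (Real.exp (inner ℝ t x)) * g x) *
          ENNReal.ofReal (Real.exp (inner ℝ t y)) ∂ν := by
        refine lintegral_congr fun y ↦ ?_
        rw [← lintegral_add_right_eq_self _ y, ← lintegral_mul_const _ (by fun_prop)]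
        refine lintegral_congr fun x ↦ ?_
        rw [add_sub_cancel_right, inner_add_right, Real.exp_add,
          ENNReal.ofReal_mul (Real.exp_nonneg _), mul_right_comm]
    _ = _ := lintegral_const_mul _ he

/-- If a continuous compactly supported nonnegative kernel `G ≠ 0` gives the same convolution
with two finite measures, then these measures have the same Laplace transform. -/
lemma lintegral_exp_inner_eq_of_convolution_eq {E : Type*} [NormedAddCommGroup E]
    [InnerProductSpace ℝ E] [FiniteDimensional ℝ E] [MeasurableSpace E] [BorelSpace E]
    {G : E → ℝ} (hGcont : Continuous G) (hGnonneg : ∀ x, 0 ≤ G x)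
    (hGsupp : HasCompactSupport G) (hGne : G ≠ 0) {μ ν : Measure E}
    [IsFiniteMeasure μ] [IsFiniteMeasure ν]
    (hconv : ∀ x, ∫ y, G (x - y) ∂μ = ∫ y, G (x - y) ∂ν) (t : E) :
    ∫⁻ y, ENNReal.ofReal (Real.exp (inner ℝ t y)) ∂μ =
      ∫⁻ y, ENNReal.ofReal (Real.exp (inner ℝ t y)) ∂ν := by
  obtain ⟨C, hC⟩ := hGsupp.exists_bound_of_continuous hGcont
  have hconv' (ρ : Measure E) [IsFiniteMeasure ρ] (x : E) :
      ∫⁻ y, ENNReal.ofReal (G (x - y)) ∂ρ = ENNReal.ofReal (∫ y, G (x - y) ∂ρ) := by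
    refine (ofReal_integral_eq_lintegral_ofReal ?_ (ae_of_all _ fun y ↦ hGnonneg _)).symm
    exact .of_bound (by fun_prop) C (ae_of_all _ fun y ↦ hC _)
  have hg : Measurable fun x ↦ ENNReal.ofReal (G x) := by fun_prop
  have hμ := lintegral_exp_inner_mul_lconvolution μ hg t
  have hν := lintegral_exp_inner_mul_lconvolution ν hg t
  simp_rw [hconv', hconv] at hμ
  simp_rw [hconv'] at hν
  have hcont : Continuous fun x ↦ Real.exp (inner ℝ t x) * G x := by fun_prop
  have hint : Integrable fun x ↦ Real.exp (inner ℝ t x) * G x :=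
    hcont.integrable_of_hasCompactSupport hGsupp.mul_left
  obtain ⟨x₀, hx₀⟩ := Function.ne_iff.mp hGne
  have hnonneg : 0 ≤ fun x ↦ Real.exp (inner ℝ t x) * G x :=
    fun x ↦ mul_nonneg (Real.exp_nonneg _) (hGnonneg x)
  have hpos : 0 < ∫ x, Real.exp (inner ℝ t x) * G x :=
    hcont.integral_pos_of_hasCompactSupport_nonneg_nonzero hGsupp.mul_left hnonneg
      (x := x₀) (mul_ne_zero (Real.exp_ne_zero _) hx₀)
  have hK : ∫⁻ x, ENNReal.ofReal (Real.exp (inner ℝ t x)) * ENNReal.ofReal (G x) =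
      ENNReal.ofReal (∫ x, Real.exp (inner ℝ t x) * G x) := by
    simp_rw [← ENNReal.ofReal_mul (Real.exp_nonneg _)]
    exact (ofReal_integral_eq_lintegral_ofReal hint (ae_of_all _ hnonneg)).symm
  rw [hK] at hμ hν
  exact (ENNReal.mul_right_inj (ENNReal.ofReal_pos.mpr hpos).ne' ENNReal.ofReal_ne_top).mp
    (hμ.symm.trans hν)

/-- The exponential moments of a compactly supported finite measure are finite. -/
lemma integrable_exp_inner_of_compl_closedBall_null {E : Type*} [NormedAddCommGroup E]
    [InnerProductSpace ℝ E] [MeasurableSpace E] [OpensMeasurableSpace E]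
    [SecondCountableTopology E] {μ : Measure E}
    [IsFiniteMeasure μ] {R : ℝ} (hR : μ (closedBall 0 R)ᶜ = 0) (t : E) :
    Integrable (fun y ↦ Real.exp (inner ℝ t y)) μ := by
  refine .of_bound (by fun_prop) (Real.exp (‖t‖ * R)) ?_
  filter_upwards [measure_eq_zero_iff_ae_notMem.mp hR] with y hy
  rw [Set.notMem_compl_iff, mem_closedBall_zero_iff] at hy
  rw [Real.norm_of_nonneg (Real.exp_nonneg _), Real.exp_le_exp]
  exact (real_inner_le_norm t y).trans (by gcongr)

open ProbabilityTheory in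
/-- Finite measures with everywhere finite exponential moments are determined by their
Laplace transform. -/
lemma MeasureTheory.Measure.ext_of_lintegral_exp_inner {E : Type*} [NormedAddCommGroup E]
    [InnerProductSpace ℝ E] [CompleteSpace E] [MeasurableSpace E] [BorelSpace E]
    [SecondCountableTopology E] {μ ν : Measure E} [IsFiniteMeasure μ] [IsFiniteMeasure ν]
    (hμ : ∀ t, Integrable (fun y ↦ Real.exp (inner ℝ t y)) μ)
    (h : ∀ t, ∫⁻ y, ENNReal.ofReal (Real.exp (inner ℝ t y)) ∂μ =
      ∫⁻ y, ENNReal.ofReal (Real.exp (inner ℝ t y)) ∂ν) :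
    μ = ν := by
  refine Measure.ext_of_charFun (funext fun t ↦ ?_)
  have hmgf : mgf (fun y ↦ inner ℝ t y) μ = mgf (fun y ↦ inner ℝ t y) ν := by
    ext s
    simp only [mgf, ← real_inner_smul_left]
    rw [integral_eq_lintegral_of_nonneg_ae (ae_of_all _ fun y ↦ Real.exp_nonneg _) (by fun_prop),
      integral_eq_lintegral_of_nonneg_ae (ae_of_all _ fun y ↦ Real.exp_nonneg _) (by fun_prop), h]
  have hzero : μ = 0 ↔ ν = 0 := by
    have := h 0
    simp only [inner_zero_left, Real.exp_zero, ENNReal.ofReal_one, lintegral_one] at this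
    rw [← Measure.measure_univ_eq_zero, this, Measure.measure_univ_eq_zero]
  have huniv : integrableExpSet (fun y ↦ inner ℝ t y) μ = Set.univ := by
    ext s
    simpa [integrableExpSet, real_inner_smul_left] using hμ (s • t)
  have := eqOn_complexMGF_of_mgf' hmgf hzero (x := Complex.I) (by simp [huniv])
  simpa only [complexMGF, charFun_apply, mul_comm Complex.I, real_inner_comm] using this

/-- Injectivity of convolution with a nonzero compactly supported kernel: if
`G : ℝ³ → [0,∞)` is continuous, compactly supported and not identically zero,
and `λ, μ` are finite nonnegative compactly supported Borel measures on `ℝ³`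
with `G * λ = G * μ`, then `λ = μ`. -/
theorem stmt_16 (G : EuclideanSpace ℝ (Fin 3) → ℝ)
    (hGcont : Continuous G) (hGnonneg : ∀ x, 0 ≤ G x)
    (hGsupp : HasCompactSupport G) (hGne : G ≠ 0)
    (lam μ : Measure (EuclideanSpace ℝ (Fin 3)))
    [IsFiniteMeasure lam] [IsFiniteMeasure μ]
    (hlamsupp : ∃ R : ℝ, lam (closedBall 0 R)ᶜ = 0)
    (hμsupp : ∃ R : ℝ, μ (closedBall 0 R)ᶜ = 0)
    (hconv : ∀ x, ∫ y, G (x - y) ∂lam = ∫ y, G (x - y) ∂μ) :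
    lam = μ := by
  obtain ⟨R, hR⟩ := hlamsupp
  exact Measure.ext_of_lintegral_exp_inner
    (integrable_exp_inner_of_compl_closedBall_null hR)
    (lintegral_exp_inner_eq_of_convolution_eq hGcont hGnonneg hGsupp hGne hconv)
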